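/- Let A = {d_1, d_1 + 1, …, d_1 + n − 1} be a set of n ≥ 2 consecutive positive integers that minimally generates the numerical semigroup it spans (equivalently, n ≤ d_1). Then the toric ideal I_A is a complete intersection if and only if n = 2, or n = 3 and d_1 is even. -/

import Mathlib

open MvPolynomial

/-- The `(p,q)`-Fibonacci sequence: `F 0 = 0`, `F 1 = 1`, `F (n+2) = p * F (n+1) + q * F n`. -/
def pqFib (p q : ℕ) : ℕ → ℕ
  | 0 => 0
  | 1 => 1
  | n + 2 => p * pqFib p q (n + 1) + q * pqFib p q n

/-- The `(p,q)`-Lucas sequence: `L 0 = 2`, `L 1 = p`, `L (n+2) = p * L (n+1) + q * L n`. -/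
def pqLucas (p q : ℕ) : ℕ → ℕ
  | 0 => 2
  | 1 => p
  | n + 2 => p * pqLucas p q (n + 1) + q * pqLucas p q n

/-- The toric ideal of the affine monomial curve `t ↦ (t^{d 0}, …, t^{d (n-1)})`:
the kernel of the `k`-algebra map `k[x_1,…,x_n] → k[t]`, `x_i ↦ t^{d i}`. -/
noncomputable def toricIdeal (k : Type*) [Field k] {n : ℕ} (d : Fin n → ℕ) :
    Ideal (MvPolynomial (Fin n) k) :=
  RingHom.ker (MvPolynomial.aeval
    (fun i : Fin n => (Polynomial.X : Polynomial k) ^ d i)).toRingHom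

/-- The toric ideal `I_A` is a complete intersection iff it can be generated by
`n - 1` elements. -/
def IsCI (k : Type*) [Field k] {n : ℕ} (d : Fin n → ℕ) : Prop :=
  ∃ g : Fin (n - 1) → MvPolynomial (Fin n) k,
    Ideal.span (Set.range g) = toricIdeal k d

/-- The toric ideal of the projective monomial curve: the kernel of the `k`-algebra map
`k[x_1,…,x_{n+1}] → k[t,u]`, `x_i ↦ t^{d i} u^{D - d i}` for `i ≤ n` and
`x_{n+1} ↦ u^D`, where `D = max A`. -/
noncomputable def projToricIdeal (k : Type*) [Field k] {n : ℕ} (d : Fin n → ℕ) :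
    Ideal (MvPolynomial (Fin (n + 1)) k) :=
  RingHom.ker (MvPolynomial.aeval (fun i : Fin (n + 1) =>
    if h : (i : ℕ) < n then
      (X 0 : MvPolynomial (Fin 2) k) ^ d ⟨i, h⟩ *
        (X 1 : MvPolynomial (Fin 2) k) ^ (Finset.univ.sup d - d ⟨i, h⟩)
    else (X 1 : MvPolynomial (Fin 2) k) ^ (Finset.univ.sup d))).toRingHom

/-- The projective toric ideal `I_{A*}` is a complete intersection iff it can be
generated by `n - 1` elements. -/
def ProjIsCI (k : Type*) [Field k] {n : ℕ} (d : Fin n → ℕ) : Prop :=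
  ∃ g : Fin (n - 1) → MvPolynomial (Fin (n + 1)) k,
    Ideal.span (Set.range g) = projToricIdeal k d

/-- `d 0 < d 1 < ⋯` is a generalized arithmetic sequence: there are positive
integers `h, e` with `d i = h * d 0 + i * e` for every `i ≥ 1`. -/
def IsGenArith {n : ℕ} (d : Fin n → ℕ) : Prop :=
  ∃ h e : ℕ, 0 < h ∧ 0 < e ∧
    ∀ i : Fin n, 0 < (i : ℕ) → d i = h * d ⟨0, i.pos⟩ + (i : ℕ) * e

/-- `d 0 < d 1 < ⋯` is an increasing arithmetic sequence: there is a positive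
integer `e` with `d i = d 0 + i * e` for every `i`. -/
def IsArithFn {n : ℕ} (d : Fin n → ℕ) : Prop :=
  ∃ e : ℕ, 0 < e ∧ ∀ i : Fin n, 0 < (i : ℕ) → d i = d ⟨0, i.pos⟩ + (i : ℕ) * e

/-- `A = {d 0, …, d (n-1)}` minimally generates the numerical semigroup
`ℕ d 0 + ⋯ + ℕ d (n-1)`: no `d i` lies in the subsemigroup generated by the rest. -/
def MinimallyGenerates {n : ℕ} (d : Fin n → ℕ) : Prop :=
  ∀ i : Fin n, ¬ ∃ α : Fin n → ℕ, α i = 0 ∧ d i = ∑ j, α j * d j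

/-- weighted degree -/
def wdeg {n : ℕ} (d : Fin n → ℕ) (w : Fin n →₀ ℕ) : ℕ := ∑ j, w j * d j

lemma wdeg_add {n : ℕ} (d : Fin n → ℕ) (u w : Fin n →₀ ℕ) :
    wdeg d (u + w) = wdeg d u + wdeg d w := by
  simp [wdeg, add_mul, Finset.sum_add_distrib]

lemma wdeg_single {n : ℕ} (d : Fin n → ℕ) (i : Fin n) (m : ℕ) :
    wdeg d (Finsupp.single i m) = m * d i := by
  unfold wdeg
  rw [Finset.sum_eq_single i]
  · simp
  · intro j _ hj
    simp [Ne.symm hj]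
  · simp

lemma aeval_mono {k : Type*} [Field k] {n : ℕ} (d : Fin n → ℕ) (w : Fin n →₀ ℕ) (c : k) :
    MvPolynomial.aeval (fun i : Fin n => (Polynomial.X : Polynomial k) ^ d i) (monomial w c)
      = Polynomial.monomial (wdeg d w) c := by
  rw [MvPolynomial.aeval_monomial, Finsupp.prod_fintype _ _ (by simp)]
  simp only [← pow_mul, Finset.prod_pow_eq_pow_sum, wdeg]
  rw [← Polynomial.C_mul_X_pow_eq_monomial]
  simp [mul_comm]

lemma mem_toric {k : Type*} [Field k] {n : ℕ} (d : Fin n → ℕ) (f : MvPolynomial (Fin n) k) :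
    f ∈ toricIdeal k d ↔
    MvPolynomial.aeval (fun i : Fin n => (Polynomial.X : Polynomial k) ^ d i) f = 0 := by
  simp [toricIdeal, RingHom.mem_ker]

lemma binom_mem {k : Type*} [Field k] {n : ℕ} (d : Fin n → ℕ) (u v : Fin n →₀ ℕ)
    (h : wdeg d u = wdeg d v) : monomial u (1:k) - monomial v 1 ∈ toricIdeal k d := by
  rw [mem_toric, map_sub, aeval_mono, aeval_mono, h, sub_self]

lemma coeff_zero_of_fiber {k : Type*} [Field k] {n : ℕ} (d : Fin n → ℕ) (u : Fin n →₀ ℕ)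
    (hu : ∀ w, wdeg d w = wdeg d u → w = u) (f : MvPolynomial (Fin n) k)
    (hf : f ∈ toricIdeal k d) : coeff u f = 0 := by
  rw [mem_toric] at hf
  have key : ∀ f : MvPolynomial (Fin n) k,
     (MvPolynomial.aeval (fun i : Fin n => (Polynomial.X : Polynomial k) ^ d i) f).coeff (wdeg d u)
       = coeff u f := by
    intro f
    induction f using MvPolynomial.induction_on' with
    | monomial w c =>
      rw [aeval_mono, Polynomial.coeff_monomial, coeff_monomial]
      by_cases h : w = u
      · simp [h]
      · rw [if_neg h, if_neg (fun h' => h (hu w h'))]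
    | add p q hp hq => simp [hp, hq]
  rw [← key, hf]; simp

lemma coeff_mul_of_fiber {k : Type*} [Field k] {n : ℕ} (d : Fin n → ℕ) (u : Fin n →₀ ℕ)
    (hu : ∀ j w, u j ≠ 0 → wdeg d w + d j = wdeg d u → w + Finsupp.single j 1 = u)
    (c : MvPolynomial (Fin n) k) : ∀ g ∈ toricIdeal k d,
      coeff u (c * g) = coeff 0 c * coeff u g := by
  induction c using MvPolynomial.induction_on with
  | C a => intro g _; simp
  | add p q hp hq => intro g hg; rw [add_mul, coeff_add, hp g hg, hq g hg, coeff_add, add_mul]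
  | mul_X p j hp =>
    intro g hg
    have e : p * X j * g = (p * g) * X j := by ring
    rw [e, coeff_mul_X', coeff_mul_X']
    simp only [Finsupp.support_zero, Finset.notMem_empty, if_false, zero_mul]
    split_ifs with h
    · have h1 : u j ≠ 0 := by simpa using h
      have e2 : u - Finsupp.single j 1 + Finsupp.single j 1 = u := by
        apply tsub_add_cancel_of_le
        rw [Finsupp.single_le_iff]; omega
      have e3 : wdeg d (u - Finsupp.single j 1) + d j = wdeg d u := by
        conv_rhs => rw [← e2, wdeg_add, wdeg_single, one_mul]
      apply coeff_zero_of_fiber d _ _ _ (Ideal.mul_mem_left _ _ hg)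
      intro w hw
      have := hu j w h1 (by rw [hw, e3])
      rw [← this, add_tsub_cancel_right]
    · rfl

lemma not_CI {k : Type*} [Field k] {n : ℕ} {ι : Type} [Fintype ι] [DecidableEq ι]
    (hn : n - 1 < Fintype.card ι) (d : Fin n → ℕ)
    (u v : ι → (Fin n →₀ ℕ)) (huv : ∀ i, wdeg d (u i) = wdeg d (v i))
    (hinj : Function.Injective u) (hne : ∀ i j, v i ≠ u j)
    (hu : ∀ i j w, u i j ≠ 0 → wdeg d w + d j = wdeg d (u i) →
      w + Finsupp.single j 1 = u i) : ¬ IsCI k d := by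
  rintro ⟨g, hg⟩
  have hgm : ∀ l, g l ∈ toricIdeal k d := fun l => hg ▸ Ideal.subset_span ⟨l, rfl⟩
  have hex : ∀ i, ∃ c : Fin (n-1) → MvPolynomial (Fin n) k,
      ∑ l, c l * g l = monomial (u i) (1:k) - monomial (v i) 1 := by
    intro i
    have := binom_mem (k := k) d (u i) (v i) (huv i)
    rw [← hg] at this
    exact Ideal.mem_span_range_iff_exists_fun.1 this
  choose c hc using hex
  let A : Matrix ι (Fin (n-1)) k := fun i l => coeff 0 (c i l)
  let B : Matrix (Fin (n-1)) ι k := fun l j => coeff (u j) (g l)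
  have hAB : A * B = 1 := by
    ext i j
    have h1 := congrArg (coeff (u j)) (hc i)
    rw [coeff_sum, coeff_sub, coeff_monomial, coeff_monomial, if_neg (hne i j), sub_zero] at h1
    rw [Matrix.mul_apply, Matrix.one_apply]
    simp only [A, B]
    rw [Finset.sum_congr rfl (fun l _ => (coeff_mul_of_fiber d (u j) (hu j) (c i l) (g l) (hgm l)).symm), h1]
    simp [hinj.eq_iff]
  have r1 : (A * B).rank = Fintype.card ι := by rw [hAB, Matrix.rank_one]
  have r2 := Matrix.rank_mul_le_left A B
  have r3 := Matrix.rank_le_card_width A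
  rw [Fintype.card_fin] at r3
  omega

lemma toric_le {k : Type*} [Field k] {n : ℕ} (d : Fin n → ℕ) (J : Ideal (MvPolynomial (Fin n) k))
    (h : ∀ u v, wdeg d u = wdeg d v → monomial u (1:k) - monomial v 1 ∈ J) :
    toricIdeal k d ≤ J := by
  classical
  let r : ℕ → MvPolynomial (Fin n) k := fun s =>
    if hs : ∃ w, wdeg d w = s then monomial hs.choose 1 else 0
  have key : ∀ f : MvPolynomial (Fin n) k,
     f - (MvPolynomial.aeval (fun i : Fin n => (Polynomial.X : Polynomial k) ^ d i) f).sum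
       (fun s c => C c * r s) ∈ J := by
    intro f
    induction f using MvPolynomial.induction_on' with
    | monomial w c =>
      rw [aeval_mono, Polynomial.sum_monomial_index _ _ (by simp)]
      have hs : ∃ w', wdeg d w' = wdeg d w := ⟨w, rfl⟩
      have hr : r (wdeg d w) = monomial hs.choose 1 := dif_pos hs
      have e : monomial w c = C c * monomial w (1:k) := by simp [C_mul_monomial]
      rw [hr, e, ← mul_sub]
      exact Ideal.mul_mem_left _ _ (h _ _ hs.choose_spec.symm)
    | add p q hp hq =>
      rw [map_add, Polynomial.sum_add_index _ _ _ (by simp) (by intros; simp [add_mul])]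
      have := J.add_mem hp hq
      convert this using 1; ring
  intro f hf
  have := key f
  rw [(mem_toric d f).1 hf] at this
  simpa using this

lemma ring_two {R : Type*} [CommRing R] (x y : R) (a : ℕ) (ha : 0 < a) (h : x ^ (a+1) = y ^ a) :
    ∀ u0 u1 v0 v1 : ℕ, u0 * a + u1 * (a+1) = v0 * a + v1 * (a+1) →
      x ^ u0 * y ^ u1 = x ^ v0 * y ^ v1 := by
  have key : ∀ u0 u1 v0 v1 : ℕ, v1 ≤ u1 → u0 * a + u1 * (a+1) = v0 * a + v1 * (a+1) →
      x ^ u0 * y ^ u1 = x ^ v0 * y ^ v1 := by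
    intro u0 u1 v0 v1 hle he
    obtain ⟨c, rfl⟩ := Nat.exists_eq_add_of_le hle
    have h1 : u0 * a + c * (a+1) = v0 * a := by nlinarith
    have h2 : a ∣ c * (a+1) := (Nat.dvd_add_right (Dvd.intro_left u0 rfl)).1
      (h1 ▸ Dvd.intro_left v0 rfl)
    have h3 : a ∣ c := Nat.Coprime.dvd_of_dvd_mul_right (by simp) h2
    obtain ⟨q, rfl⟩ := h3
    have h4 : v0 = u0 + (a+1) * q := by
      apply Nat.eq_of_mul_eq_mul_right ha
      rw [← h1]; ring
    rw [h4, pow_add, pow_add, pow_mul, pow_mul, h]; ring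
  intro u0 u1 v0 v1 he
  rcases le_total v1 u1 with h1 | h1
  · exact key _ _ _ _ h1 he
  · exact (key _ _ _ _ h1 he.symm).symm

lemma ring_three {R : Type*} [CommRing R] (x y z : R) (m : ℕ) (hm : 0 < m)
    (h : x ^ (m+1) = z ^ m) (hy : y ^ 2 = x * z) (u0 u1 u2 v0 v1 v2 : ℕ)
    (he : u0 * (2*m) + u1 * (2*m+1) + u2 * (2*m+2) = v0 * (2*m) + v1 * (2*m+1) + v2 * (2*m+2)) :
    x ^ u0 * y ^ u1 * z ^ u2 = x ^ v0 * y ^ v1 * z ^ v2 := by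
  have hp : u1 % 2 = v1 % 2 := by
    have e1 : u1 + 2 * (u0 * m + u1 * m + u2 * (m+1)) = v1 + 2 * (v0 * m + v1 * m + v2 * (m+1)) := by
      linarith
    omega
  have red : ∀ a b c : ℕ, x ^ a * y ^ b * z ^ c =
      (x ^ (a + b/2) * z ^ (c + b/2)) * y ^ (b % 2) := by
    intro a b c
    have : y ^ b = y ^ (b % 2) * (x * z) ^ (b / 2) := by
      conv_lhs => rw [← Nat.mod_add_div b 2, pow_add, pow_mul, hy]
    rw [this, mul_pow]; ring
  rw [red, red, hp]
  congr 1
  apply ring_two x z m hm h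
  have e1 := Nat.mod_add_div u1 2
  have e2 := Nat.mod_add_div v1 2
  rw [hp] at e1
  generalize u1 / 2 = r at *
  generalize v1 / 2 = r' at *
  generalize v1 % 2 = e at *
  subst e1 e2
  nlinarith

lemma ci_two (k : Type*) [Field k] (a : ℕ) (ha : 0 < a) :
    IsCI k (fun i : Fin 2 => a + (i : ℕ)) := by
  refine ⟨fun _ => monomial (Finsupp.single 0 (a+1)) 1 - monomial (Finsupp.single 1 a) 1, ?_⟩
  apply le_antisymm
  · rw [Ideal.span_le]
    rintro _ ⟨i, rfl⟩
    apply binom_mem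
    rw [wdeg_single, wdeg_single]; simp; ring
  · apply toric_le
    intro u v huv
    set J := Ideal.span (Set.range (fun _ : Fin (2-1) =>
      (monomial (Finsupp.single 0 (a+1)) 1 - monomial (Finsupp.single 1 a) 1 : MvPolynomial (Fin 2) k)))
    have hJ : (monomial (Finsupp.single 0 (a+1)) 1 - monomial (Finsupp.single 1 a) 1 : MvPolynomial (Fin 2) k) ∈ J :=
      Ideal.subset_span ⟨0, rfl⟩
    rw [← Ideal.Quotient.eq] at hJ ⊢
    simp only [monomial_eq, Finsupp.prod_fintype _ _ (fun i => pow_zero _), Fin.prod_univ_two,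
      map_mul, map_pow, map_one, one_mul] at hJ ⊢
    simp at hJ
    apply ring_two _ _ a ha hJ
    simpa [wdeg, Fin.sum_univ_two] using huv

lemma ci_three (k : Type*) [Field k] (m : ℕ) (hm : 0 < m) :
    IsCI k (fun i : Fin 3 => 2*m + (i : ℕ)) := by
  refine ⟨![monomial (Finsupp.single 0 (m+1)) 1 - monomial (Finsupp.single 2 m) 1,
    monomial (Finsupp.single 1 2) 1 - monomial (Finsupp.single 0 1 + Finsupp.single 2 1) 1], ?_⟩
  apply le_antisymm
  · rw [Ideal.span_le]
    rintro _ ⟨i, rfl⟩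
    fin_cases i
    · apply binom_mem
      rw [wdeg_single, wdeg_single]; simp; ring
    · apply binom_mem
      rw [wdeg_add, wdeg_single, wdeg_single, wdeg_single]; simp; ring
  · apply toric_le
    intro u v huv
    set g : Fin (3-1) → MvPolynomial (Fin 3) k := ![monomial (Finsupp.single 0 (m+1)) 1 - monomial (Finsupp.single 2 m) 1,
      monomial (Finsupp.single 1 2) 1 - monomial (Finsupp.single 0 1 + Finsupp.single 2 1) 1] with hg
    set J := Ideal.span (Set.range g)
    have hJ : (monomial (Finsupp.single 0 (m+1)) 1 - monomial (Finsupp.single 2 m) 1 : MvPolynomial (Fin 3) k) ∈ J :=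
      Ideal.subset_span ⟨0, rfl⟩
    have hJ2 : (monomial (Finsupp.single 1 2) 1 - monomial (Finsupp.single 0 1 + Finsupp.single 2 1) 1 : MvPolynomial (Fin 3) k) ∈ J :=
      Ideal.subset_span ⟨1, rfl⟩
    rw [← Ideal.Quotient.eq] at hJ hJ2 ⊢
    simp only [monomial_eq, Finsupp.prod_fintype _ _ (fun i => pow_zero _), Fin.prod_univ_three,
      map_mul, map_pow, map_one, one_mul] at hJ hJ2 ⊢
    simp at hJ hJ2
    apply ring_three _ _ _ m hm hJ hJ2
    simpa [wdeg, Fin.sum_univ_three] using huv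

/-! fibers -/

lemma eq_single_of {n : ℕ} (d : Fin n → ℕ) (w : Fin n →₀ ℕ) (p : Fin n) (m : ℕ)
    (h0 : ∀ j, j ≠ p → w j = 0) (hd : 0 < d p) (h : wdeg d w = m * d p) :
    w = Finsupp.single p m := by
  have e : w = Finsupp.single p (w p) := by
    ext j
    by_cases hj : j = p
    · simp [hj]
    · rw [h0 j hj, Finsupp.single_apply, if_neg (Ne.symm hj)]
  rw [e, wdeg_single] at h
  rw [e, Nat.eq_of_mul_eq_mul_right hd h]

lemma fiber_top {n : ℕ} (a : ℕ) (ha : 0 < a) (p : Fin n) (hp : (p : ℕ) + 1 = n) (m : ℕ)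
    (hm : m * p < a) (w : Fin n →₀ ℕ)
    (h : wdeg (fun i : Fin n => a + (i : ℕ)) w = m * (a + p)) : w = Finsupp.single p m := by
  have hle : ∀ j ∈ Finset.univ, w j * (a + (j : ℕ)) ≤ w j * (a + p) := fun j _ =>
    Nat.mul_le_mul_left _ (by omega)
  have h1 : wdeg (fun i : Fin n => a + (i : ℕ)) w ≤ (∑ j, w j) * (a + p) := by
    rw [Finset.sum_mul]; exact Finset.sum_le_sum hle
  have h2 : (∑ j, w j) * a ≤ wdeg (fun i : Fin n => a + (i : ℕ)) w := by
    rw [Finset.sum_mul]; exact Finset.sum_le_sum (fun j _ => Nat.mul_le_mul_left _ (by show a ≤ a + (j : ℕ); omega))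
  rw [h] at h1 h2
  have h3 : m ≤ ∑ j, w j := Nat.le_of_mul_le_mul_right h1 (by omega)
  have h4 : ∑ j, w j < m + 1 := by
    by_contra hc
    push Not at hc
    have := Nat.mul_le_mul_right a hc
    nlinarith
  have h5 : ∑ j, w j = m := by omega
  have h6 : ∑ j, w j * (a + (j : ℕ)) = ∑ j, w j * (a + (p : ℕ)) := by
    rw [← Finset.sum_mul, h5, ← h]; rfl
  have h7 := (Finset.sum_eq_sum_iff_of_le hle).1 h6
  apply eq_single_of (fun i : Fin n => a + (i : ℕ)) w p m _ (by simp; omega) h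
  intro j hj
  have h8 := h7 j (Finset.mem_univ _)
  by_contra hc
  have := Nat.eq_of_mul_eq_mul_left (Nat.pos_of_ne_zero hc) h8
  apply hj; ext; omega

lemma fiber_bot {n : ℕ} (a : ℕ) (ha : 0 < a) (p z : Fin n) (hp : (p : ℕ) + 1 = n)
    (hz : (z : ℕ) = 0) (m : ℕ)
    (hm : m * p < a + p) (w : Fin n →₀ ℕ)
    (h : wdeg (fun i : Fin n => a + (i : ℕ)) w = m * a) : w = Finsupp.single z m := by
  have hle : ∀ j ∈ Finset.univ, w j * a ≤ w j * (a + (j : ℕ)) := fun j _ =>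
    Nat.mul_le_mul_left _ (by omega)
  have h1 : wdeg (fun i : Fin n => a + (i : ℕ)) w ≤ (∑ j, w j) * (a + p) := by
    rw [Finset.sum_mul]; exact Finset.sum_le_sum (fun j _ => Nat.mul_le_mul_left _ (by show a + (j : ℕ) ≤ a + p; omega))
  have h2 : (∑ j, w j) * a ≤ wdeg (fun i : Fin n => a + (i : ℕ)) w := by
    rw [Finset.sum_mul]; exact Finset.sum_le_sum hle
  rw [h] at h1 h2
  have h3 : ∑ j, w j ≤ m := Nat.le_of_mul_le_mul_right h2 (by omega)
  have h4 : m < ∑ j, w j + 1 := by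
    by_contra hc
    push Not at hc
    have := Nat.mul_le_mul_right (a + p) hc
    nlinarith
  have h5 : ∑ j, w j = m := by omega
  have h6 : ∑ j, w j * a = ∑ j, w j * (a + (j : ℕ)) := by
    rw [← Finset.sum_mul, h5, ← h]; rfl
  have h7 := (Finset.sum_eq_sum_iff_of_le hle).1 h6
  apply eq_single_of (fun i : Fin n => a + (i : ℕ)) w z m _ (by simp; omega) (by simp [h, hz])
  intro j hj
  have h8 := h7 j (Finset.mem_univ _)
  by_contra hc
  have := Nat.eq_of_mul_eq_mul_left (Nat.pos_of_ne_zero hc) h8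
  apply hj; ext; omega

lemma fiber_single {n : ℕ} (d : Fin n → ℕ) (hd : ∀ i, 0 < d i) (hmin : MinimallyGenerates d)
    (i : Fin n) (w : Fin n →₀ ℕ) (h : wdeg d w = d i) : w = Finsupp.single i 1 := by
  have h1 : w i ≠ 0 := fun h0 => hmin i ⟨w, h0, h.symm⟩
  have e2 : w - Finsupp.single i 1 + Finsupp.single i 1 = w := by
    apply tsub_add_cancel_of_le
    rw [Finsupp.single_le_iff]; omega
  have h3 : wdeg d (w - Finsupp.single i 1) = 0 := by
    have := congrArg (wdeg d) e2
    rw [wdeg_add, wdeg_single, h] at this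
    omega
  have h4 : w - Finsupp.single i 1 = 0 := by
    ext j
    have := (Finset.sum_eq_zero_iff.1 h3) j (Finset.mem_univ _)
    rcases Nat.mul_eq_zero.1 this with h | h
    · exact h
    · exact absurd h (hd j).ne'
  rw [← e2, h4, zero_add]

lemma quad_fiber {n : ℕ} (d : Fin n → ℕ) (hd : ∀ i, 0 < d i) (hmin : MinimallyGenerates d)
    (s t : Fin n) (j : Fin n) (w : Fin n →₀ ℕ)
    (hj : (Finsupp.single s 1 + Finsupp.single t 1 : Fin n →₀ ℕ) j ≠ 0)
    (h : wdeg d w + d j = wdeg d (Finsupp.single s 1 + Finsupp.single t 1)) :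
    w + Finsupp.single j 1 = Finsupp.single s 1 + Finsupp.single t 1 := by
  rw [wdeg_add, wdeg_single, wdeg_single] at h
  by_cases h1 : j = s
  · subst h1
    rw [fiber_single d hd hmin t w (by omega), add_comm]
  · by_cases h2 : j = t
    · subst h2
      rw [fiber_single d hd hmin s w (by omega)]
    · simp [Ne.symm h1, Ne.symm h2] at hj

lemma pure_fiber {n : ℕ} (d : Fin n → ℕ) (p : Fin n) (m : ℕ)
    (hf : ∀ w, wdeg d w = m * d p → w = Finsupp.single p m) (j : Fin n) (w : Fin n →₀ ℕ)
    (hj : (Finsupp.single p (m+1) : Fin n →₀ ℕ) j ≠ 0)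
    (h : wdeg d w + d j = wdeg d (Finsupp.single p (m+1))) :
    w + Finsupp.single j 1 = Finsupp.single p (m+1) := by
  have : j = p := by
    by_contra hc
    simp [Ne.symm hc] at hj
  subst this
  rw [wdeg_single, add_mul, one_mul] at h
  rw [hf w (by omega), ← Finsupp.single_add]

lemma le_of_min {n a : ℕ} (ha : 0 < a) (hmin : MinimallyGenerates (fun i : Fin n => a + (i : ℕ))) :
    n ≤ a := by
  by_contra hc
  push Not at hc
  apply hmin ⟨a, hc⟩
  have := wdeg_single (fun i : Fin n => a + (i : ℕ)) ⟨0, by omega⟩ 2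
  refine ⟨Finsupp.single ⟨0, by omega⟩ 2, ?_, ?_⟩
  · rw [Finsupp.single_apply, if_neg]
    simp; omega
  · unfold wdeg at this
    rw [this]; simp; omega

lemma quad_inj {n : ℕ} (s t b c : Fin n) (h1 : s < t)
    (h : (Finsupp.single s 1 + Finsupp.single t 1 : Fin n →₀ ℕ) =
      Finsupp.single b 1 + Finsupp.single c 1) : (s = b ∧ t = c) ∨ (s = c ∧ t = b) := by
  have e1 := DFunLike.congr_fun h s
  have e2 := DFunLike.congr_fun h t
  simp only [Finsupp.add_apply, Finsupp.single_apply] at e1 e2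
  grind

lemma quad_ne {n : ℕ} (s t p : Fin n) (m : ℕ) (hm : 2 ≤ m) (h1 : s ≠ t) (w : Fin n →₀ ℕ)
    (h : (Finsupp.single s 1 + Finsupp.single t 1 : Fin n →₀ ℕ) = Finsupp.single p m + w) :
    False := by
  have e1 := DFunLike.congr_fun h p
  simp only [Finsupp.add_apply, Finsupp.single_apply] at e1
  grind

lemma quad_ne' {n : ℕ} (b c p : Fin n) (m : ℕ) (h1 : b ≠ p)
    (h : (Finsupp.single b 1 + Finsupp.single c 1 : Fin n →₀ ℕ) = Finsupp.single p m) :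
    False := by
  have e1 := DFunLike.congr_fun h b
  simp only [Finsupp.add_apply, Finsupp.single_apply] at e1
  grind

lemma not_ci_four (k : Type*) [Field k] (N a : ℕ) (ha : 0 < a)
    (hmin : MinimallyGenerates (fun i : Fin (N+4) => a + (i : ℕ))) :
    ¬ IsCI k (fun i : Fin (N+4) => a + (i : ℕ)) := by
  have hna := le_of_min ha hmin
  obtain ⟨m, hm1, hm2⟩ : ∃ m, m * (N+3) < a ∧ a ≤ (m+1) * (N+3) := by
    refine ⟨(a-1)/(N+3), ?_, ?_⟩
    · have := Nat.div_mul_le_self (a-1) (N+3); omega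
    · have := Nat.lt_div_mul_add (a := a-1) (b := N+3) (by omega)
      rw [add_mul]; omega
  have hm0 : 1 ≤ m := by
    by_contra hc
    have : m = 0 := by omega
    subst this; omega
  have hm3 : (m+1) * (N+3) = m * (N+3) + (N+3) := by ring
  let p : Fin (N+4) := ⟨N+3, by omega⟩
  let s : Fin (N+3) → Fin (N+4) := fun i => if h : (i : ℕ) < N+2 then ⟨i, by omega⟩ else ⟨0, by omega⟩
  let t : Fin (N+3) → Fin (N+4) := fun i => if h : (i : ℕ) < N+2 then ⟨i+2, by omega⟩ else ⟨3, by omega⟩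
  let b : Fin (N+3) → Fin (N+4) := fun i => if h : (i : ℕ) < N+2 then ⟨i+1, by omega⟩ else ⟨1, by omega⟩
  let c : Fin (N+3) → Fin (N+4) := fun i => if h : (i : ℕ) < N+2 then ⟨i+1, by omega⟩ else ⟨2, by omega⟩
  have hst : ∀ i, (s i : ℕ) + 2 ≤ t i := by
    intro i; simp only [s, t]; split_ifs <;> simp
  have hbc : ∀ i, (b i : ℕ) ≤ c i ∧ (c i : ℕ) ≤ b i + 1 ∧ (b i : ℕ) < N + 3 := by
    intro i; simp only [b, c]; split_ifs <;> simp <;> omega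
  have hsum : ∀ i, (s i : ℕ) + t i = b i + c i := by
    intro i; simp only [s, t, b, c]; split_ifs <;> simp; omega
  have hsti : ∀ i j, s i = s j → t i = t j → i = j := by
    intro i j h1 h2
    simp only [s, t] at h1 h2
    ext
    split_ifs at h1 h2 <;> simp only [Fin.mk.injEq] at h1 h2 <;> omega
  let r : Fin (N+4) := ⟨(m+1) * (N+3) - a, by omega⟩
  apply not_CI (ι := Option (Fin (N+3))) (by simp) _
    (fun i => i.elim (Finsupp.single p (m+1)) (fun i => Finsupp.single (s i) 1 + Finsupp.single (t i) 1))
    (fun i => i.elim (Finsupp.single 0 (m+1) + Finsupp.single r 1)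
      (fun i => Finsupp.single (b i) 1 + Finsupp.single (c i) 1))
  · rintro (_ | i)
    · simp only [Option.elim, wdeg_add, wdeg_single]
      simp only [r, p, Fin.val_zero, add_zero]
      rw [mul_add (m+1)]
      omega
    · simp only [Option.elim, wdeg_add, wdeg_single]
      have := hsum i
      omega
  · rintro (_ | i) (_ | j) h
    · rfl
    · exact (quad_ne (s j) (t j) p (m+1) (by omega) (by have := hst j; intro h; rw [h] at this; omega) 0
        (by rw [add_zero]; exact h.symm)).elim
    · exact (quad_ne (s i) (t i) p (m+1) (by omega) (by have := hst i; intro h; rw [h] at this; omega) 0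
        (by rw [add_zero]; exact h)).elim
    · have h1 := hst i
      have h2 := hst j
      rcases quad_inj (s i) (t i) (s j) (t j) (by rw [Fin.lt_def]; omega) h with h | h
      · rw [hsti i j h.1 h.2]
      · rw [h.1, h.2] at h1; omega
  · rintro (_ | i) (_ | j) h
    · have := DFunLike.congr_fun h 0
      simp [p, Finsupp.single_apply] at this
    · exact (quad_ne (s j) (t j) 0 (m+1) (by omega) (by have := hst j; intro h; rw [h] at this; omega) _ h.symm)
    · apply quad_ne' (b i) (c i) p (m+1) _ h
      have := hbc i
      intro h'
      rw [h'] at this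
      simp [p] at this
    · have h1 := hst j
      have h2 := hbc i
      rcases quad_inj (s j) (t j) (b i) (c i) (by rw [Fin.lt_def]; omega) h.symm with h | h <;>
        rw [h.1, h.2] at h1 <;> omega
  · rintro (_ | i) j w
    · apply pure_fiber
      intro w hw
      exact fiber_top a ha p rfl m hm1 w hw
    · apply quad_fiber _ _ hmin
      intro i; simp; omega

lemma not_ci_three (k : Type*) [Field k] (q : ℕ)
    (hmin : MinimallyGenerates (fun i : Fin 3 => 2 * q + 1 + (i : ℕ))) :
    ¬ IsCI k (fun i : Fin 3 => 2 * q + 1 + (i : ℕ)) := by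
  have hna := le_of_min (by omega) hmin
  apply not_CI (ι := Fin 3) (by simp) _
    ![Finsupp.single 0 1 + Finsupp.single 2 1, Finsupp.single 2 (q+1), Finsupp.single 0 (q+1+1)]
    ![Finsupp.single 1 1 + Finsupp.single 1 1, Finsupp.single 0 (q+1) + Finsupp.single 1 1,
      Finsupp.single 1 1 + Finsupp.single 2 q]
  · intro i
    fin_cases i <;> simp [wdeg_add, wdeg_single] <;> ring
  · intro i j h
    have h0 := DFunLike.congr_fun h 0
    have h2 := DFunLike.congr_fun h 2
    fin_cases i <;> fin_cases j <;> simp [Finsupp.single_apply] at h0 h2 ⊢ <;> omega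
  · intro i j h
    have h0 := DFunLike.congr_fun h 1
    fin_cases i <;> fin_cases j <;> simp [Finsupp.single_apply] at h0
  · intro i j w
    fin_cases i
    · apply quad_fiber _ _ hmin
      intro i; simp
    · apply pure_fiber
      intro w hw
      exact fiber_top (2*q+1) (by omega) 2 rfl q (by simp; omega) w hw
    · apply pure_fiber
      intro w hw
      exact fiber_bot (2*q+1) (by omega) 2 0 rfl rfl (q+1) (by simp; omega) w hw

/-- For a set `A = {d₁, d₁+1, …, d₁+n−1}` of `n ≥ 2` consecutive
positive integers that minimally generates its numerical semigroup, the toric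
ideal `I_A` is a complete intersection iff `n = 2`, or `n = 3` and `d₁` is even. -/
theorem stmt2 (k : Type*) [Field k] (n : ℕ) (d₁ : ℕ)
    (hn : 2 ≤ n) (hpos : 0 < d₁)
    (hmin : MinimallyGenerates (fun i : Fin n => d₁ + (i : ℕ))) :
    IsCI k (fun i : Fin n => d₁ + (i : ℕ)) ↔ n = 2 ∨ (n = 3 ∧ Even d₁) := by
  constructor
  · intro h
    rcases Nat.lt_or_ge n 4 with h4 | h4
    · have : n = 2 ∨ n = 3 := by omega
      rcases this with rfl | rfl
      · exact Or.inl rfl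
      · right
        refine ⟨rfl, ?_⟩
        by_contra hc
        rw [Nat.not_even_iff_odd] at hc
        obtain ⟨q, rfl⟩ := hc
        exact not_ci_three k q hmin h
    · obtain ⟨N, rfl⟩ := Nat.exists_eq_add_of_le' h4
      exact absurd h (not_ci_four k N d₁ hpos hmin)
  · rintro (rfl | ⟨rfl, h⟩)
    · exact ci_two k d₁ hpos
    · obtain ⟨m, rfl⟩ := h
      have := ci_three k m (by omega)
      rw [two_mul] at this
      exact this
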